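/- Let G be a forest and x ∈ SOL(G). Then there exists a maximal independent set S of G with S ⊆ σ(x), the support of x. -/

import Mathlib

open Matrix Finset

/-- `x` solves the linear complementarity problem `LCP(A + I, -e)`, where `A` is the
adjacency matrix of the simple graph `G`, `I` is the identity matrix and `e` is the
all-ones vector: `x ≥ 0`, `(A+I)x ≥ e`, and `xᵀ((A+I)x − e) = 0`. -/
def SolLCP {V : Type*} [Fintype V] [DecidableEq V] (G : SimpleGraph V) [DecidableRel G.Adj]
    (x : V → ℝ) : Prop :=
  (∀ i, 0 ≤ x i) ∧
  (∀ i, 1 ≤ ((G.adjMatrix ℝ + 1) *ᵥ x) i) ∧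
  ∑ i, x i * (((G.adjMatrix ℝ + 1) *ᵥ x) i - 1) = 0

/-- `S` is an independent set of the simple graph `G`: its vertices are pairwise nonadjacent. -/
def IsIndepFinset {V : Type*} (G : SimpleGraph V) (S : Finset V) : Prop :=
  ∀ i ∈ S, ∀ j ∈ S, ¬ G.Adj i j

/-- `S` is a maximal independent set of `G`: it is independent and is not properly
contained in any larger independent set. -/
def IsMaxIndepFinset {V : Type*} (G : SimpleGraph V) (S : Finset V) : Prop :=
  IsIndepFinset G S ∧ ∀ T : Finset V, IsIndepFinset G T → S ⊆ T → S = T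

/-- A forest admits a height function (the distance to a root of each component) which separates
adjacent vertices and for which every vertex has at most one lower neighbour. -/
theorem SimpleGraph.IsAcyclic.exists_height {V : Type*} {G : SimpleGraph V} (hG : G.IsAcyclic) :
    ∃ d : V → ℕ, (∀ u v, G.Adj u v → d u ≠ d v) ∧
      ∀ v p q, G.Adj v p → G.Adj v q → d p < d v → d q < d v → p = q := by
  classical
  let r : V → V := fun v => (G.connectedComponentMk v).out
  have hr : ∀ v, G.Reachable (r v) v := fun v =>
    SimpleGraph.ConnectedComponent.exact (Quot.out_eq (G.connectedComponentMk v))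
  have hadj : ∀ u v, G.Adj u v → r u = r v := fun u v h => by
    have : G.connectedComponentMk u = G.connectedComponentMk v :=
      SimpleGraph.ConnectedComponent.sound h.reachable
    simp only [r, this]
  refine ⟨fun v => G.dist (r v) v, fun u v h => ?_, fun v p q hp hq hdp hdq => ?_⟩
  · simp only [← hadj u v h]
    exact hG.dist_ne_of_adj h (hr u)
  · have key : ∀ p, G.Adj v p → G.dist (r p) p < G.dist (r v) v →
        ∃ w : G.Walk (r v) v, w.IsPath ∧ w.penultimate = p := by
      intro p hp hd
      rw [← hadj v p hp] at hd
      obtain ⟨w, hw, hlen⟩ := (hadj v p hp ▸ hr p : G.Reachable (r v) p).exists_path_of_dist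
      refine ⟨w.concat hp.symm, hw.concat (fun hv => ?_) hp.symm, by simp⟩
      have h₁ := SimpleGraph.dist_le (w.takeUntil v hv)
      have h₂ := w.length_takeUntil_le_length hv
      omega
    obtain ⟨w₁, h₁, rfl⟩ := key p hp hdp
    obtain ⟨w₂, h₂, rfl⟩ := key q hq hdq
    have := congrArg Subtype.val ((hG.subsingleton_path _ _).elim ⟨w₁, h₁⟩ ⟨w₂, h₂⟩)
    simp only at this
    rw [this]

/-- An independent set meeting the closed neighbourhood of every vertex is maximal independent. -/
theorem IsIndepFinset.isMaxIndepFinset {V : Type*} {G : SimpleGraph V} {S : Finset V}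
    (hS : IsIndepFinset G S) (hdom : ∀ v ∉ S, ∃ u ∈ S, G.Adj v u) : IsMaxIndepFinset G S := by
  refine ⟨hS, fun T hT hST => hST.antisymm fun v hv => ?_⟩
  by_contra hvS
  obtain ⟨u, hu, huv⟩ := hdom v hvS
  exact hT v hv u (hST hu) huv

section SolLCP

variable {V : Type*} [Fintype V] [DecidableEq V] {G : SimpleGraph V} [DecidableRel G.Adj]
  {x : V → ℝ}

theorem adjMatrix_add_one_mulVec_apply (x : V → ℝ) (i : V) :
    ((G.adjMatrix ℝ + 1) *ᵥ x) i = ∑ j ∈ G.neighborFinset i, x j + x i := by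
  simp [Matrix.add_mulVec, SimpleGraph.adjMatrix_mulVec_apply]

theorem SolLCP.one_le_sum (hx : SolLCP G x) (i : V) :
    1 ≤ ∑ j ∈ G.neighborFinset i, x j + x i :=
  adjMatrix_add_one_mulVec_apply (G := G) x i ▸ hx.2.1 i

theorem SolLCP.sum_eq_one (hx : SolLCP G x) {i : V} (hi : 0 < x i) :
    ∑ j ∈ G.neighborFinset i, x j + x i = 1 := by
  have h := (Finset.sum_eq_zero_iff_of_nonneg fun j _ =>
    mul_nonneg (hx.1 j) (sub_nonneg.2 (hx.2.1 j))).1 hx.2.2 i (Finset.mem_univ i)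
  rw [adjMatrix_add_one_mulVec_apply] at h
  rcases mul_eq_zero.1 h with h | h <;> linarith

/-- If all neighbours of `v` except possibly `p` vanish, the mass around `v` sits on `v`
and `p`. -/
theorem SolLCP.one_le_add_of_forall_eq_zero (hx : SolLCP G x) {v p : V}
    (h : ∀ c, G.Adj v c → c ≠ p → x c = 0) : 1 ≤ x p + x v := by
  have hsum : ∑ j ∈ G.neighborFinset v, x j ≤ ∑ j ∈ {p}, x j := by
    rw [← Finset.sum_subset (Finset.inter_subset_left (s₂ := {p})) fun c hc hcp =>
      h c (by simpa using hc) (by rintro rfl; simp_all)]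
    exact Finset.sum_le_sum_of_subset_of_nonneg Finset.inter_subset_right fun _ _ _ => hx.1 _
  have := hx.one_le_sum v
  rw [Finset.sum_singleton] at hsum
  linarith

theorem SolLCP.sum_add_le_one (hx : SolLCP G x) {p : V} (hp : 0 < x p) {s : Finset V}
    (hs : ∀ j ∈ s, G.Adj p j) : ∑ j ∈ s, x j + x p ≤ 1 := by
  rw [← hx.sum_eq_one hp]
  gcongr
  · exact fun _ _ _ => hx.1 _
  · exact fun j hj => by simpa using hs j hj

/-- Along a height function of the forest, the support contains no path descending twice. -/
theorem SolLCP.not_descending {d : V → ℕ} (hne : ∀ u v, G.Adj u v → d u ≠ d v)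
    (huniq : ∀ v p q, G.Adj v p → G.Adj v q → d p < d v → d q < d v → p = q)
    (hx : SolLCP G x) {v p q : V} (hvp : G.Adj v p) (hpq : G.Adj p q) (hv : 0 < x v)
    (hp : 0 < x p) (hq : 0 < x q) (hdp : d p < d v) : ¬ d q < d p := by
  intro hdq
  obtain ⟨c, hvc, hcp, hc⟩ : ∃ c, G.Adj v c ∧ c ≠ p ∧ x c ≠ 0 := by
    by_contra! hcon
    have h₁ := hx.one_le_add_of_forall_eq_zero hcon
    have hvq : v ≠ q := by rintro rfl; omega
    have h₂ := hx.sum_add_le_one hp (s := {v, q}) (by simp [hvp.symm, hpq])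
    rw [Finset.sum_pair hvq] at h₂
    linarith
  have hdc : d v < d c := by
    by_contra hcon
    have := hne v c hvc
    exact hcp (huniq v c p hvc hvp (by omega) hdp)
  have hcb := Finset.le_sup (f := d) (Finset.mem_univ c)
  exact hx.not_descending hne huniq hvc.symm hvp ((hx.1 c).lt_of_ne' hc) hv hp hdc hdp
termination_by Finset.univ.sup d - d v

end SolLCP

/-- For a forest `G` and any solution `x` of `LCP(G)`, there exists a maximal independent
set `S` of `G` contained in the support `σ(x) = {i : x i > 0}`. -/
theorem stmt_15 {n : ℕ} (G : SimpleGraph (Fin n)) [DecidableRel G.Adj] (hG : G.IsAcyclic)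
    (x : Fin n → ℝ) (hx : SolLCP G x) :
    ∃ S : Finset (Fin n), IsMaxIndepFinset G S ∧ ∀ i ∈ S, 0 < x i := by
  classical
  obtain ⟨d, hne, huniq⟩ := hG.exists_height
  -- the vertices of the support without a lower neighbour in the support
  let S : Finset (Fin n) := {i | 0 < x i ∧ ∀ j, G.Adj i j → 0 < x j → d i ≤ d j}
  have hS : ∀ i, i ∈ S ↔ 0 < x i ∧ ∀ j, G.Adj i j → 0 < x j → d i ≤ d j := fun i => by simp [S]
  refine ⟨S, IsIndepFinset.isMaxIndepFinset ?_ ?_, fun i hi => ((hS i).1 hi).1⟩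
  · intro i hi j hj hij
    rw [hS] at hi hj
    exact hne i j hij ((hi.2 j hij hj.1).antisymm (hj.2 i hij.symm hi.1))
  · intro v hv
    rcases (hx.1 v).eq_or_lt with h0 | hpos
    · by_cases hup : ∃ u, G.Adj v u ∧ 0 < x u ∧ d v < d u
      · obtain ⟨u, hvu, hu, hd⟩ := hup
        refine ⟨u, (hS u).2 ⟨hu, fun j huj hj => ?_⟩, hvu⟩
        by_contra! hlt
        obtain rfl := huniq u v j hvu.symm huj hd hlt
        linarith
      · push Not at hup
        obtain ⟨p, hvp, hp⟩ : ∃ p, G.Adj v p ∧ 0 < x p := by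
          by_contra! hcon
          have := hx.one_le_add_of_forall_eq_zero (v := v) (p := v)
            fun c hc _ => (hcon c hc).antisymm (hx.1 c)
          linarith
        have hlow : ∀ c, G.Adj v c → 0 < x c → d c < d v := fun c hc hxc =>
          (hup c hc hxc).lt_of_ne (hne v c hc).symm
        have h₁ : 1 ≤ x p + x v := hx.one_le_add_of_forall_eq_zero fun c hc hcp => by
          by_contra h
          have hc0 := (hx.1 c).lt_of_ne' h
          exact hcp (huniq v c p hc hvp (hlow c hc hc0) (hlow p hvp hp))
        refine ⟨p, (hS p).2 ⟨hp, fun j hpj hj => ?_⟩, hvp⟩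
        have h₂ := hx.sum_add_le_one hp (s := {j}) (by simpa using hpj)
        rw [Finset.sum_singleton] at h₂
        linarith
    · obtain ⟨p, hvp, hp, hd⟩ : ∃ p, G.Adj v p ∧ 0 < x p ∧ d p < d v := by
        by_contra! hcon
        exact hv ((hS v).2 ⟨hpos, hcon⟩)
      exact ⟨p, (hS p).2 ⟨hp, fun q hpq hq => not_lt.1
        (hx.not_descending hne huniq hvp hpq hpos hp hq hd)⟩, hvp⟩
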